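/- For a topological dynamical system (X,T), the following are equivalent: (1) (X,T) is Ē-continuous; (2) the family of empirical measure maps x ↦ m_T(x,n), n ∈ ℕ, is uniformly equicontinuous from (X,d) to (M(X), ρ); (3) every x ∈ X is generic for some invariant measure μ(x) and the map x ↦ μ(x) is continuous; (4) for every continuous f: X → ℝ the ergodic averages (1/n)Σ_{k<n} f∘T^k converge uniformly on X to a continuous function. -/

import Mathlib

open Filter MeasureTheory Topology
open scoped ENNReal NNReal

noncomputable def EnDist {X : Type*} [MetricSpace X] (T : X → X) (n : ℕ) (x y : X) : ℝ :=
  ⨅ σ : Equiv.Perm (Fin n), (1 / (n : ℝ)) * ∑ k : Fin n, dist (T^[(k : ℕ)] x) (T^[((σ k) : ℕ)] y)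

/-- The mean orbital pseudo-metric `Ē(x,y) = limsup_n Ē_n(x,y)`. -/
noncomputable def Ebar {X : Type*} [MetricSpace X] (T : X → X) (x y : X) : ℝ :=
  Filter.limsup (fun n => EnDist T n x y) Filter.atTop

/-- The empirical measure `m_T(x,n) = (1/n) Σ_{j<n} δ_{T^j x}`. -/
noncomputable def empMeas {X : Type*} [MeasurableSpace X] (T : X → X) (x : X) (n : ℕ) :
    Measure X :=
  ((n : ℝ≥0∞))⁻¹ • ∑ j ∈ Finset.range n, MeasureTheory.Measure.dirac (T^[j] x)

/-- The empirical measure `m_T(x,n+1)` as a probability measure; the sequence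
`n ↦ empProb T x n` is the sequence of empirical measures of `x`. -/
noncomputable def empProb {X : Type*} [MeasurableSpace X] (T : X → X) (x : X) (n : ℕ) :
    ProbabilityMeasure X :=
  ⟨empMeas T x (n + 1), by
    constructor
    rw [empMeas, Measure.smul_apply, Measure.finset_sum_apply]
    simp only [measure_univ, Finset.sum_const, Finset.card_range, nsmul_eq_mul, mul_one,
      smul_eq_mul]
    rw [ENNReal.inv_mul_cancel (by exact_mod_cast Nat.succ_ne_zero n) (by simp)]⟩

/-- `ω̂_T(x)`: the set of measures quasi-generated by `x`, i.e. the weak* limit points of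
the sequence of empirical measures of `x`. -/
noncomputable def omegaHat {X : Type*} [MetricSpace X] [MeasurableSpace X]
    [OpensMeasurableSpace X] (T : X → X) (x : X) : Set (ProbabilityMeasure X) :=
  {μ | MapClusterPt μ Filter.atTop (empProb T x)}

/-- The Prokhorov metric on probability measures. -/
noncomputable def rhoP {X : Type*} [MetricSpace X] [MeasurableSpace X]
    (μ ν : ProbabilityMeasure X) : ℝ :=
  levyProkhorovDist μ.toMeasure ν.toMeasure

/-- The Hausdorff distance induced by the Prokhorov metric. -/
noncomputable def rhoH {X : Type*} [MetricSpace X] [MeasurableSpace X]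
    (A B : Set (ProbabilityMeasure X)) : ℝ :=
  max (⨆ μ ∈ A, ⨅ ν ∈ B, rhoP μ ν) (⨆ ν ∈ B, ⨅ μ ∈ A, rhoP μ ν)


section EbarHelpers

set_option linter.unusedSectionVars false

variable {X : Type*} [MetricSpace X] [CompactSpace X]

/-- Ergodic averages. -/
noncomputable def avT (T : X → X) (f : X → ℝ) (n : ℕ) (x : X) : ℝ :=
  (1 / (n : ℝ)) * ∑ k ∈ Finset.range n, f (T^[k] x)

lemma sum_bdd_of_neg (T : X → X) (hT : Continuous T) (u : X → ℝ) (hu : Continuous u)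
    (h : ∀ x, ∃ n : ℕ, 0 < n ∧ ∑ k ∈ Finset.range n, u (T^[k] x) < 0) :
    ∃ C : ℝ, ∀ n x, ∑ k ∈ Finset.range n, u (T^[k] x) ≤ C := by
  classical
  choose p hp0 hp using h
  let U : X → Set X := fun x => {y | ∑ k ∈ Finset.range (p x), u (T^[k] y) < 0}
  have hU : ∀ x ∈ (Set.univ : Set X), U x ∈ 𝓝 x := by
    intro x _
    refine IsOpen.mem_nhds ?_ (hp x)
    refine isOpen_lt ?_ continuous_const
    exact continuous_finsetSum _ fun k _ => hu.comp (hT.iterate k)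
  obtain ⟨t, -, ht⟩ := isCompact_univ.elim_nhds_subcover U hU
  let N := t.sup p
  have hN : ∀ y, ∃ q : ℕ, 0 < q ∧ q ≤ N ∧ ∑ k ∈ Finset.range q, u (T^[k] y) < 0 := by
    intro y
    have := ht (Set.mem_univ y)
    simp only [Set.mem_iUnion] at this
    obtain ⟨x, hx, hy⟩ := this
    exact ⟨p x, hp0 x, Finset.le_sup hx, hy⟩
  obtain ⟨C, hC⟩ := (isCompact_univ (X := X)).bddAbove_image hu.continuousOn
  have hC' : ∀ x, u x ≤ max C 0 := fun x =>
    (hC ⟨x, Set.mem_univ x, rfl⟩).trans (le_max_left _ _)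
  refine ⟨N * max C 0, ?_⟩
  intro n
  induction n using Nat.strong_induction_on with
  | _ n ih =>
    intro x
    rcases lt_or_ge n N with hn | hn
    · calc ∑ k ∈ Finset.range n, u (T^[k] x) ≤ ∑ k ∈ Finset.range n, max C 0 :=
            Finset.sum_le_sum fun k _ => hC' _
        _ = n * max C 0 := by simp
        _ ≤ N * max C 0 := by
            have : (n : ℝ) ≤ N := by exact_mod_cast hn.le
            exact mul_le_mul_of_nonneg_right this (le_max_right _ _)
    · obtain ⟨q, hq0, hqN, hq⟩ := hN x
      have hqn : q + (n - q) = n := by omega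
      rw [← hqn, Finset.sum_range_add]
      have := ih (n - q) (by omega) (T^[q] x)
      have e : ∀ k, T^[q + k] x = T^[k] (T^[q] x) := by
        intro k; rw [add_comm, Function.iterate_add_apply]
      simp only [e]
      linarith

lemma avT_upper (T : X → X) (hT : Continuous T) (f h : X → ℝ) (hf : Continuous f)
    (hh : Continuous h) (hinv : ∀ x, h (T x) = h x)
    (hn : ∀ x, ∀ ε > 0, ∃ n : ℕ, 0 < n ∧ avT T f n x < h x + ε) :
    ∀ ε > 0, ∀ᶠ n : ℕ in atTop, ∀ x, avT T f n x ≤ h x + ε := by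
  intro ε hε
  have hinv' : ∀ k x, h (T^[k] x) = h x := by
    intro k
    induction k with
    | zero => intro x; rfl
    | succ k ih => intro x; rw [Function.iterate_succ_apply, ih, hinv]
  have hsum : ∀ n x, ∑ k ∈ Finset.range n, (f (T^[k] x) - h (T^[k] x) - ε / 2)
      = ∑ k ∈ Finset.range n, f (T^[k] x) - n * (h x + ε / 2) := by
    intro n x
    simp only [hinv', Finset.sum_sub_distrib, Finset.sum_const, Finset.card_range, nsmul_eq_mul]
    ring
  obtain ⟨C, hC⟩ := sum_bdd_of_neg T hT (fun x => f x - h x - ε / 2) (by fun_prop) (by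
    intro x
    obtain ⟨n, hn0, hlt⟩ := hn x (ε / 2) (by positivity)
    refine ⟨n, hn0, ?_⟩
    rw [hsum]
    have hn0' : (0 : ℝ) < n := by exact_mod_cast hn0
    rw [avT, one_div, inv_mul_lt_iff₀ hn0'] at hlt
    linarith)
  have hl : Tendsto (fun n : ℕ => C / (n : ℝ)) atTop (𝓝 0) :=
    tendsto_const_div_atTop_nhds_zero_nat C
  filter_upwards [hl.eventually_lt_const (show (0 : ℝ) < ε / 2 by positivity),
    eventually_gt_atTop 0] with n h1 h2 x
  have hn0' : (0 : ℝ) < n := by exact_mod_cast h2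
  have := hC n x
  rw [hsum] at this
  rw [avT, one_div, inv_mul_le_iff₀ hn0']
  rw [div_lt_iff₀ hn0'] at h1
  linarith

lemma avT_neg (T : X → X) (f : X → ℝ) (n : ℕ) (x : X) :
    avT T (fun y => - f y) n x = - avT T f n x := by
  simp [avT]

/-- two-sided version -/
lemma avT_uniform (T : X → X) (hT : Continuous T) (f h : X → ℝ) (hf : Continuous f)
    (hh : Continuous h) (hinv : ∀ x, h (T x) = h x)
    (hn : ∀ x, ∀ ε > 0, ∃ n : ℕ, 0 < n ∧ avT T f n x < h x + ε)
    (h' : X → ℝ) (hh' : Continuous h') (hinv' : ∀ x, h' (T x) = h' x)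
    (hn' : ∀ x, ∀ ε > 0, ∃ n : ℕ, 0 < n ∧ - avT T f n x < h' x + ε)
    (hle : ∀ x, h x + h' x ≤ 0) :
    TendstoUniformly (avT T f) h atTop := by
  rw [Metric.tendstoUniformly_iff]
  intro ε hε
  filter_upwards [avT_upper T hT f h hf hh hinv hn (ε / 2) (by positivity),
    avT_upper T hT (fun y => - f y) h' hf.neg hh' hinv'
      (by simpa only [avT_neg] using hn') (ε / 2) (by positivity)] with n h1 h2 x
  have := h1 x
  have h2 := h2 x
  have h3 := hle x
  rw [avT_neg] at h2
  rw [Real.dist_eq, abs_lt]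
  constructor <;> linarith

lemma exists_bound (f : X → ℝ) (hf : Continuous f) : ∃ C : ℝ, 0 ≤ C ∧ ∀ x, |f x| ≤ C := by
  obtain ⟨C, hC⟩ := (isCompact_univ (X := X)).bddAbove_image hf.abs.continuousOn
  exact ⟨max C 0, le_max_right _ _, fun x => (hC ⟨x, Set.mem_univ x, rfl⟩).trans (le_max_left _ _)⟩


lemma avT_abs_le (T : X → X) (f : X → ℝ) {C : ℝ} (hC0 : 0 ≤ C) (hC : ∀ x, |f x| ≤ C)
    (n : ℕ) (x : X) : |avT T f n x| ≤ C := by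
  rcases Nat.eq_zero_or_pos n with rfl | hn
  · simpa [avT] using hC0
  have hn0' : (0 : ℝ) < n := by exact_mod_cast hn
  rw [avT, abs_mul, one_div, abs_of_pos (inv_pos.2 hn0'), inv_mul_le_iff₀ hn0']
  refine (Finset.abs_sum_le_sum_abs _ _).trans ?_
  refine (Finset.sum_le_sum fun k _ => hC _).trans ?_
  simp

lemma avT_shift (T : X → X) (f : X → ℝ) (hf : Continuous f) (x : X) :
    Tendsto (fun n => avT T f n (T x) - avT T f n x) atTop (𝓝 0) := by
  obtain ⟨C, hC0, hC⟩ := exists_bound f hf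
  have hl : Tendsto (fun n : ℕ => (2 * C) / (n : ℝ)) atTop (𝓝 0) :=
    tendsto_const_div_atTop_nhds_zero_nat _
  refine squeeze_zero_norm (fun n => ?_) hl
  have : avT T f n (T x) - avT T f n x = (1 / (n : ℝ)) * (f (T^[n] x) - f x) := by
    have h1 := Finset.sum_range_succ (fun k => f (T^[k] x)) n
    have h2 := Finset.sum_range_succ' (fun k => f (T^[k] x)) n
    simp only [Function.iterate_succ_apply, Function.iterate_zero, id] at h2
    simp only [avT]
    rw [← mul_sub]
    congr 1
    linarith
  rw [this, Real.norm_eq_abs, abs_mul, abs_of_nonneg (by positivity), one_div, div_eq_inv_mul]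
  refine mul_le_mul_of_nonneg_left ?_ (by positivity)
  have a := hC (T^[n] x)
  have b := hC x
  rw [abs_le] at *
  constructor <;> linarith

lemma liminf_le_add {a b : ℕ → ℝ} {C ε : ℝ} (ha : ∀ n, |a n| ≤ C) (hb : ∀ n, |b n| ≤ C)
    (h : ∀ᶠ n in atTop, a n ≤ b n + ε) : liminf a atTop ≤ liminf b atTop + ε := by
  refine le_of_forall_lt fun c hc => ?_
  obtain ⟨c', hc', hc''⟩ := exists_between hc
  have h1 := eventually_lt_of_lt_liminf hc''
    (isBoundedUnder_of ⟨-C, fun n => (abs_le.1 (ha n)).1⟩)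
  have : c' - ε ≤ liminf b atTop := by
    refine le_liminf_of_le ?_ ?_
    · exact IsBoundedUnder.isCoboundedUnder_ge (isBoundedUnder_of ⟨C, fun n => (abs_le.1 (hb n)).2⟩)
    · filter_upwards [h, h1] with n h1 h2
      linarith
  linarith

lemma liminf_props {a : ℕ → ℝ} {C : ℝ} (ha : ∀ n, |a n| ≤ C) :
    (∀ ε > 0, ∃ n : ℕ, 0 < n ∧ a n < liminf a atTop + ε) ∧
    liminf a atTop + liminf (fun n => - a n) atTop ≤ 0 := by
  have hbd : IsBoundedUnder (· ≥ ·) atTop a :=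
    isBoundedUnder_of ⟨-C, fun n => (abs_le.1 (ha n)).1⟩
  have hco : IsCoboundedUnder (· ≥ ·) atTop a :=
    IsBoundedUnder.isCoboundedUnder_ge (isBoundedUnder_of ⟨C, fun n => (abs_le.1 (ha n)).2⟩)
  constructor
  · intro ε hε
    by_contra hcon
    push Not at hcon
    have : liminf a atTop + ε ≤ liminf a atTop := by
      refine le_liminf_of_le hco ?_
      filter_upwards [eventually_gt_atTop 0] with n hn using hcon n hn
    linarith
  · by_contra hcon
    push Not at hcon
    set s := liminf a atTop
    set t := liminf (fun n => - a n) atTop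
    have h1 : ∀ᶠ n in atTop, s - (s + t) / 2 < a n :=
      eventually_lt_of_lt_liminf (by linarith) hbd
    have h2 : ∀ᶠ n in atTop, t - (s + t) / 2 < - a n :=
      eventually_lt_of_lt_liminf (by linarith)
        (isBoundedUnder_of ⟨-C, fun n => by have := (abs_le.1 (ha n)).2; simpa using this⟩)
    obtain ⟨n, h1, h2⟩ := (h1.and h2).exists
    linarith

/-- Asymptotic equicontinuity of the averages gives uniform convergence. -/
lemma five_imp_four (T : X → X) (hT : Continuous T)
    (H : ∀ f : X → ℝ, Continuous f → ∀ ε > 0, ∃ δ > 0, ∀ x y : X, dist x y < δ →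
      ∀ᶠ n in atTop, |avT T f n x - avT T f n y| ≤ ε)
    (f : X → ℝ) (hf : Continuous f) :
    ∃ g : C(X, ℝ), TendstoUniformly (avT T f) g atTop := by
  have key : ∀ f : X → ℝ, Continuous f → Continuous (fun x => liminf (fun n => avT T f n x) atTop)
      ∧ ∀ x, liminf (fun n => avT T f n (T x)) atTop = liminf (fun n => avT T f n x) atTop := by
    intro f hf
    obtain ⟨C, hC0, hC⟩ := exists_bound f hf
    have hb := avT_abs_le T f hC0 hC
    constructor
    · rw [Metric.continuous_iff]
      intro b ε hε
      obtain ⟨δ, hδ, h⟩ := H f hf (ε / 2) (by positivity)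
      refine ⟨δ, hδ, fun a hab => ?_⟩
      have h0 := h a b hab
      have h1 := liminf_le_add (hb · a) (hb · b) (ε := ε / 2)
        (h0.mono fun n hn => by have := (abs_le.1 hn).2; linarith)
      have h2 := liminf_le_add (hb · b) (hb · a) (ε := ε / 2)
        (h0.mono fun n hn => by have := (abs_le.1 hn).1; linarith)
      rw [Real.dist_eq, abs_lt]
      constructor <;> linarith
    · intro x
      have hs := avT_shift T f hf x
      apply le_antisymm
      · refine le_of_forall_pos_le_add fun ε hε => liminf_le_add (hb · _) (hb · _) ?_
        filter_upwards [hs.eventually_lt_const hε] with n hn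
        linarith
      · refine le_of_forall_pos_le_add fun ε hε => liminf_le_add (hb · _) (hb · _) ?_
        filter_upwards [hs.eventually_const_lt (show -ε < 0 by linarith)] with n hn
        linarith
  obtain ⟨C, hC0, hC⟩ := exists_bound f hf
  have hb := avT_abs_le T f hC0 hC
  have hb' : ∀ n x, |-avT T f n x| ≤ C := by intro n x; rw [abs_neg]; exact hb n x
  obtain ⟨k1, k2⟩ := key f hf
  obtain ⟨k3, k4⟩ := key (fun y => - f y) hf.neg
  simp only [avT_neg] at k3 k4
  exact ⟨⟨_, k1⟩, avT_uniform T hT f _ hf k1 k2 (fun x => (liminf_props (hb · x)).1) _ k3 k4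
    (fun x => (liminf_props (hb' · x)).1) (fun x => (liminf_props (hb · x)).2)⟩


lemma EnDist_nonneg (T : X → X) (n : ℕ) (x y : X) : 0 ≤ EnDist T n x y :=
  Real.iInf_nonneg fun _ => mul_nonneg (by positivity) (Finset.sum_nonneg fun _ _ => dist_nonneg)

lemma EnDist_le (T : X → X) (n : ℕ) (x y : X) (σ : Equiv.Perm (Fin n)) :
    EnDist T n x y ≤
      (1 / (n : ℝ)) * ∑ k : Fin n, dist (T^[(k : ℕ)] x) (T^[((σ k) : ℕ)] y) :=
  ciInf_le (Set.finite_range _).bddBelow σ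

lemma dist_le_D (x y : X) : dist x y ≤ Metric.diam (Set.univ : Set X) :=
  Metric.dist_le_diam_of_mem isCompact_univ.isBounded (Set.mem_univ _) (Set.mem_univ _)

lemma EnDist_le_D (T : X → X) (n : ℕ) (x y : X) :
    EnDist T n x y ≤ Metric.diam (Set.univ : Set X) := by
  refine (EnDist_le T n x y 1).trans ?_
  rcases Nat.eq_zero_or_pos n with rfl | hn
  · simpa using Metric.diam_nonneg
  have hn0' : (0 : ℝ) < n := by exact_mod_cast hn
  rw [one_div, inv_mul_le_iff₀ hn0']
  refine (Finset.sum_le_sum fun k _ => dist_le_D _ _).trans ?_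
  simp

lemma avT_diff_le (T : X → X) (f : X → ℝ) {ε K η : ℝ} (hK : 0 ≤ K) (hε : 0 ≤ ε)
    (hf : ∀ a b, |f a - f b| ≤ ε + K * dist a b) (n : ℕ) (x y : X) (h : EnDist T n x y < η) :
    |avT T f n x - avT T f n y| ≤ ε + K * η := by
  have hη : 0 ≤ η := (EnDist_nonneg T n x y).trans h.le
  rcases Nat.eq_zero_or_pos n with rfl | hn
  · simp [avT]; positivity
  have hn0' : (0 : ℝ) < n := by exact_mod_cast hn
  obtain ⟨σ, hσ⟩ := exists_lt_of_ciInf_lt h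
  rw [one_div, inv_mul_lt_iff₀ hn0'] at hσ
  have e1 : avT T f n x - avT T f n y
      = (1 / (n : ℝ)) * ∑ k : Fin n, (f (T^[(k : ℕ)] x) - f (T^[((σ k) : ℕ)] y)) := by
    rw [Finset.sum_sub_distrib, Equiv.sum_comp σ (fun k : Fin n => f (T^[(k : ℕ)] y)), avT, avT,
      Finset.sum_range, Finset.sum_range, mul_sub]
  rw [e1, abs_mul, one_div, abs_of_pos (inv_pos.2 hn0'), inv_mul_le_iff₀ hn0']
  calc |∑ k : Fin n, (f (T^[(k : ℕ)] x) - f (T^[((σ k) : ℕ)] y))|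
      ≤ ∑ k : Fin n, |f (T^[(k : ℕ)] x) - f (T^[((σ k) : ℕ)] y)| := Finset.abs_sum_le_sum_abs _ _
    _ ≤ ∑ k : Fin n, (ε + K * dist (T^[(k : ℕ)] x) (T^[((σ k) : ℕ)] y)) :=
        Finset.sum_le_sum fun k _ => hf _ _
    _ = n * ε + K * ∑ k : Fin n, dist (T^[(k : ℕ)] x) (T^[((σ k) : ℕ)] y) := by
        rw [Finset.sum_add_distrib, Finset.mul_sum]; simp
    _ ≤ n * ε + K * (n * η) := by gcongr
    _ = n * (ε + K * η) := by ring

lemma one_imp_five (T : X → X)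
    (H1 : ∀ ε > (0 : ℝ), ∃ δ > (0 : ℝ), ∀ x y : X, dist x y < δ → Ebar T x y < ε)
    (f : X → ℝ) (hf : Continuous f) : ∀ ε > 0, ∃ δ > 0, ∀ x y : X, dist x y < δ →
      ∀ᶠ n in atTop, |avT T f n x - avT T f n y| ≤ ε := by
  intro ε hε
  obtain ⟨C, hC0, hC⟩ := exists_bound f hf
  have huc := CompactSpace.uniformContinuous_of_continuous hf
  rw [Metric.uniformContinuous_iff] at huc
  obtain ⟨r, hr, hr'⟩ := huc (ε / 2) (by positivity)
  have hK : 0 ≤ 2 * C / r := by positivity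
  have hlip : ∀ a b, |f a - f b| ≤ ε / 2 + 2 * C / r * dist a b := by
    intro a b
    rcases lt_or_ge (dist a b) r with h | h
    · have := (hr' h).le
      rw [Real.dist_eq] at this
      have : 0 ≤ 2 * C / r * dist a b := by positivity
      linarith
    · have h1 : |f a - f b| ≤ 2 * C := by
        have a := hC a
        have b := hC b
        rw [abs_le] at *
        constructor <;> linarith
      have h2 : 2 * C ≤ 2 * C / r * dist a b := by
        rw [div_mul_eq_mul_div, le_div_iff₀ hr]
        exact mul_le_mul_of_nonneg_left h (by positivity)
      linarith
  set K := 2 * C / r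
  obtain ⟨δ, hδ, h⟩ := H1 (ε / (2 * (K + 1))) (by positivity)
  refine ⟨δ, hδ, fun x y hxy => ?_⟩
  have hE := h x y hxy
  rw [Ebar] at hE
  have := eventually_lt_of_limsup_lt hE (isBoundedUnder_of ⟨_, fun n => EnDist_le_D T n x y⟩)
  filter_upwards [this] with n hn
  refine (avT_diff_le T f hK (by positivity) hlip n x y hn).trans ?_
  have : K * (ε / (2 * (K + 1))) ≤ ε / 2 := by
    rw [← mul_div_assoc, div_le_div_iff₀ (by positivity) (by positivity)]
    nlinarith
  linarith

lemma hall_perm (n : ℕ) (a b : Fin n → X) {ε : ℝ} (hε : 0 ≤ ε)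
    (h : ∀ S : Finset (Fin n), ∃ R : Finset (Fin n), (∀ j ∈ R, ∃ i ∈ S, dist (a i) (b j) ≤ ε) ∧
      (S.card : ℝ) ≤ R.card + ε * n) :
    ∃ σ : Equiv.Perm (Fin n), ∑ k, dist (a k) (b (σ k)) ≤
      n * (ε * (1 + Metric.diam (Set.univ : Set X))) := by
  classical
  set D := Metric.diam (Set.univ : Set X)
  have hD : 0 ≤ D := Metric.diam_nonneg
  set d := ⌊ε * n⌋₊ with hd
  let t : Fin n → Finset (Fin n ⊕ Fin d) := fun i =>
    (Finset.univ.filter fun j => dist (a i) (b j) ≤ ε).disjSum Finset.univ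
  have hall : ∀ S : Finset (Fin n), S.card ≤ (S.biUnion t).card := by
    intro S
    rcases S.eq_empty_or_nonempty with rfl | ⟨i0, hi0⟩
    · simp
    obtain ⟨R, hR, hS⟩ := h S
    have hsub : R.disjSum (Finset.univ : Finset (Fin d)) ⊆ S.biUnion t := by
      intro z hz
      rw [Finset.mem_biUnion]
      rcases z with j | j
      · obtain ⟨i, hi, hij⟩ := hR j (by simpa using hz)
        exact ⟨i, hi, by simpa [t] using hij⟩
      · exact ⟨i0, hi0, by simp [t]⟩
    have h1 := Finset.card_le_card hsub
    rw [Finset.card_disjSum, Finset.card_univ, Fintype.card_fin] at h1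
    refine le_trans ?_ h1
    have h2 : ((S.card - R.card : ℕ) : ℝ) ≤ ε * n := by
      rcases le_total R.card S.card with h | h
      · rw [Nat.cast_sub h]; linarith
      · rw [Nat.sub_eq_zero_of_le h]; simp; positivity
    have := Nat.le_floor h2
    omega
  obtain ⟨F, hFi, hF⟩ := (Finset.all_card_le_biUnion_card_iff_exists_injective t).1 hall
  let A : Finset (Fin n) := Finset.univ.filter fun k => (F k).isLeft
  let g : Fin n → Fin n := fun k => (F k).elim id (fun _ => k)
  have hg : ∀ k ∈ A, F k = Sum.inl (g k) := by
    intro k hk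
    have : (F k).isLeft := by simpa [A] using hk
    obtain ⟨j, hj⟩ := Sum.isLeft_iff.1 this
    simp [g, hj]
  have hginj : Set.InjOn g A := by
    intro k hk l hl hkl
    apply hFi
    rw [hg k hk, hg l hl, hkl]
  obtain ⟨e, he⟩ := Finset.exists_equiv_extend_of_card_eq (α := Fin n)
    (t := (Finset.univ : Finset (Fin n))) (by simp) (s := A) (f := g) (by simp) hginj
  let σ : Equiv.Perm (Fin n) := e.trans (Equiv.subtypeUnivEquiv (by simp))
  have hσ : ∀ k ∈ A, σ k = g k := he
  have hcard : (Aᶜ).card ≤ d := by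
    have : (Aᶜ).card ≤ ((Finset.univ : Finset (Fin d)).map Function.Embedding.inr
        : Finset (Fin n ⊕ Fin d)).card := by
      refine Finset.card_le_card_of_injOn F ?_ hFi.injOn
      intro k hk
      have : ¬ (F k).isLeft := by simpa [A] using hk
      have : (F k).isRight := by simpa using this
      obtain ⟨j, hj⟩ := Sum.isRight_iff.1 this
      simp [hj]
    simpa using this
  have hcard' : ((Aᶜ).card : ℝ) ≤ ε * n :=
    (Nat.cast_le.2 hcard).trans (Nat.floor_le (by positivity))
  refine ⟨σ, ?_⟩
  rw [← Finset.sum_add_sum_compl A]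
  have s1 : ∑ k ∈ A, dist (a k) (b (σ k)) ≤ n * ε := by
    calc ∑ k ∈ A, dist (a k) (b (σ k)) ≤ ∑ k ∈ A, ε := by
          refine Finset.sum_le_sum fun k hk => ?_
          have := hF k
          rw [hg k hk] at this
          rw [hσ k hk]
          simpa [t] using this
      _ = A.card * ε := by simp
      _ ≤ n * ε := by
          have : (A.card : ℝ) ≤ n := by
            exact_mod_cast (Finset.card_le_univ A).trans (by simp)
          exact mul_le_mul_of_nonneg_right this hε
  have s2 : ∑ k ∈ Aᶜ, dist (a k) (b (σ k)) ≤ ε * n * D := by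
    calc ∑ k ∈ Aᶜ, dist (a k) (b (σ k)) ≤ ∑ k ∈ Aᶜ, D :=
          Finset.sum_le_sum fun k _ => dist_le_D _ _
      _ = (Aᶜ).card * D := by simp
      _ ≤ _ := mul_le_mul_of_nonneg_right hcard' hD
  nlinarith

variable [MeasurableSpace X] [BorelSpace X]

lemma empMeas_isProb (T : X → X) (x : X) {n : ℕ} (hn : 0 < n) :
    IsProbabilityMeasure (empMeas T x n) := by
  obtain ⟨m, rfl⟩ : ∃ m, n = m + 1 := ⟨n - 1, by omega⟩
  exact (empProb T x m).2

lemma empMeas_apply (T : X → X) (x : X) (n : ℕ) {B : Set X} (hB : MeasurableSet B)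
    (S : Finset (Fin n)) (hS : ∀ k, k ∈ S ↔ T^[(k : ℕ)] x ∈ B) :
    empMeas T x n B = (n : ℝ≥0∞)⁻¹ * S.card := by
  classical
  rw [empMeas, Measure.smul_apply, Measure.finsetSum_apply, Finset.sum_range, smul_eq_mul]
  congr 1
  simp only [Measure.dirac_apply' _ hB, Set.indicator_apply, ← hS, Pi.one_apply]
  simp

lemma EnDist_le_of_LP (T : X → X) (x y : X) {n : ℕ} (hn : 0 < n) {ε : ℝ} (hε : 0 < ε)
    (h : levyProkhorovDist (empMeas T x n) (empMeas T y n) < ε) :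
    EnDist T n x y ≤ ε * (1 + Metric.diam (Set.univ : Set X)) := by
  classical
  have := empMeas_isProb T x hn
  have := empMeas_isProb T y hn
  have hn0' : (0 : ℝ) < n := by exact_mod_cast hn
  have hlt : levyProkhorovEDist (empMeas T x n) (empMeas T y n) < ENNReal.ofReal ε := by
    rw [ENNReal.lt_ofReal_iff_toReal_lt (levyProkhorovEDist_ne_top _ _)]
    exact h
  obtain ⟨σ, hσ⟩ := hall_perm n (fun k => T^[(k : ℕ)] x) (fun k => T^[(k : ℕ)] y) hε.le (by
    intro S
    let B : Set X := (fun k : Fin n => T^[(k : ℕ)] x) '' (S : Set (Fin n))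
    have hB : MeasurableSet B := (S.finite_toSet.image _).measurableSet
    have hB' : MeasurableSet (Metric.thickening ε B) := Metric.isOpen_thickening.measurableSet
    let S' : Finset (Fin n) := Finset.univ.filter fun k => T^[(k : ℕ)] x ∈ B
    let R : Finset (Fin n) := Finset.univ.filter fun k => T^[(k : ℕ)] y ∈ Metric.thickening ε B
    refine ⟨R, ?_, ?_⟩
    · intro j hj
      have : T^[(j : ℕ)] y ∈ Metric.thickening ε B := by simpa [R] using hj
      rw [Metric.mem_thickening_iff] at this
      obtain ⟨z, ⟨i, hi, rfl⟩, hz⟩ := this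
      exact ⟨i, hi, by rw [dist_comm]; exact hz.le⟩
    · have hle := left_measure_le_of_levyProkhorovEDist_lt hlt hB
      rw [ENNReal.toReal_ofReal hε.le, empMeas_apply T x n hB S' (by simp [S']),
        empMeas_apply T y n hB' R (by simp [R])] at hle
      have h2 := ENNReal.toReal_mono (by finiteness) hle
      rw [ENNReal.toReal_add (by finiteness) (by finiteness), ENNReal.toReal_ofReal hε.le] at h2
      simp only [ENNReal.toReal_mul, ENNReal.toReal_inv, ENNReal.toReal_natCast] at h2
      have hSS : (S.card : ℝ) ≤ S'.card := by
        exact_mod_cast Finset.card_le_card (fun k hk => by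
          simp only [S', Finset.mem_filter, Finset.mem_univ, true_and]
          exact ⟨k, hk, rfl⟩)
      rw [inv_mul_le_iff₀ hn0', mul_add, mul_inv_cancel_left₀ hn0'.ne'] at h2
      linarith)
  refine (EnDist_le T n x y σ).trans ?_
  rw [one_div, inv_mul_le_iff₀ hn0']
  exact hσ

lemma two_imp_one (T : X → X)
    (H : ∀ ε > (0 : ℝ), ∃ δ > (0 : ℝ), ∀ x y : X, ∀ n : ℕ, 0 < n → dist x y < δ →
        levyProkhorovDist (empMeas T x n) (empMeas T y n) < ε) :
    ∀ ε > (0 : ℝ), ∃ δ > (0 : ℝ), ∀ x y : X, dist x y < δ → Ebar T x y < ε := by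
  intro ε hε
  have hD : 0 ≤ Metric.diam (Set.univ : Set X) := Metric.diam_nonneg
  set D := Metric.diam (Set.univ : Set X) with hDdef
  obtain ⟨δ, hδ, h⟩ := H (ε / (2 * (1 + D))) (by positivity)
  refine ⟨δ, hδ, fun x y hxy => ?_⟩
  have : Ebar T x y ≤ ε / 2 := by
    rw [Ebar]
    refine limsup_le_of_le ?_ ?_
    · exact IsBoundedUnder.isCoboundedUnder_le
        (isBoundedUnder_of ⟨0, fun n => EnDist_nonneg T n x y⟩)
    · filter_upwards [eventually_gt_atTop 0] with n hn
      refine (EnDist_le_of_LP T x y hn (by positivity) (h x y n hn hxy)).trans (le_of_eq ?_)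
      rw [← hDdef]
      field_simp
  linarith

lemma integrable_cont (μ : Measure X) [IsFiniteMeasure μ] (f : C(X, ℝ)) : Integrable f μ :=
  (BoundedContinuousFunction.mkOfCompact f).integrable μ

lemma integral_empProb (T : X → X) (f : C(X, ℝ)) (x : X) (n : ℕ) :
    ∫ y, f y ∂(empProb T x n : Measure X) = avT T f (n + 1) x := by
  change ∫ y, f y ∂(empMeas T x (n + 1)) = _
  rw [empMeas, integral_smul_measure, integral_finsetSum_measure, avT]
  · simp only [integral_dirac, ENNReal.toReal_inv, ENNReal.toReal_natCast, smul_eq_mul, one_div]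
  · intro i _
    exact integrable_cont _ f

lemma tendsto_PM_iff {ι : Type*} {F : Filter ι} (μs : ι → ProbabilityMeasure X)
    (μ : ProbabilityMeasure X) : Tendsto μs F (𝓝 μ) ↔
      ∀ f : C(X, ℝ), Tendsto (fun i => ∫ y, f y ∂(μs i : Measure X)) F
        (𝓝 (∫ y, f y ∂(μ : Measure X))) := by
  rw [ProbabilityMeasure.tendsto_iff_forall_integral_tendsto]
  constructor
  · intro h f
    exact h (BoundedContinuousFunction.mkOfCompact f)
  · intro h f
    exact h f.toContinuousMap

lemma PM_ext (μ ν : ProbabilityMeasure X)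
    (h : ∀ f : C(X, ℝ), ∫ y, f y ∂(μ : Measure X) = ∫ y, f y ∂(ν : Measure X)) : μ = ν := by
  apply Subtype.ext
  have h1 : IsProbabilityMeasure (μ : Measure X) := inferInstance
  have h2 : IsProbabilityMeasure (ν : Measure X) := inferInstance
  change (μ : Measure X) = (ν : Measure X)
  exact ext_of_forall_integral_eq_of_IsFiniteMeasure fun f => h f.toContinuousMap

lemma three_imp_four (T : X → X) (hT : Continuous T)
    (H : ∃ m : X → ProbabilityMeasure X, Continuous m ∧
        (∀ x : X, Measure.map T (m x).toMeasure = (m x).toMeasure) ∧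
        (∀ x : X, Tendsto (empProb T x) atTop (𝓝 (m x)))) (f : C(X, ℝ)) :
    ∃ g : C(X, ℝ), TendstoUniformly (avT T f) g atTop := by
  obtain ⟨m, hm, -, hgen⟩ := H
  let h : X → ℝ := fun x => ∫ y, f y ∂(m x : Measure X)
  have hc : Continuous h := (ProbabilityMeasure.continuous_integral_continuousMap f).comp hm
  have hl : ∀ x, Tendsto (fun n => avT T f n x) atTop (𝓝 (h x)) := by
    intro x
    have := (tendsto_PM_iff _ _).1 (hgen x) f
    simp only [integral_empProb] at this
    exact (tendsto_add_atTop_iff_nat 1).1 this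
  have hinv : ∀ x, h (T x) = h x := by
    intro x
    have := (avT_shift T f f.continuous x).add (hl x)
    simp only [sub_add_cancel, zero_add] at this
    exact tendsto_nhds_unique (hl (T x)) this
  refine ⟨⟨h, hc⟩, avT_uniform T hT f h f.continuous hc hinv ?_ (fun x => - h x) hc.neg
    (fun x => by rw [hinv]) ?_ (fun x => by simp)⟩
  · intro x ε hε
    obtain ⟨n, h1, h2⟩ := ((eventually_gt_atTop 0).and
      ((hl x).eventually_lt_const (show h x < h x + ε by linarith))).exists
    exact ⟨n, h1, h2⟩
  · intro x ε hε
    obtain ⟨n, h1, h2⟩ := ((eventually_gt_atTop 0).and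
      ((hl x).neg.eventually_lt_const (show - h x < - h x + ε by linarith))).exists
    exact ⟨n, h1, h2⟩

lemma four_imp_three (T : X → X) (hT : Continuous T)
    (H : ∀ f : C(X, ℝ), ∃ g : C(X, ℝ), TendstoUniformly (avT T f) g atTop) :
    ∃ m : X → ProbabilityMeasure X, Continuous m ∧
        (∀ x : X, Measure.map T (m x).toMeasure = (m x).toMeasure) ∧
        (∀ x : X, Tendsto (empProb T x) atTop (𝓝 (m x))) := by
  choose g hg using H
  have hl : ∀ (f : C(X, ℝ)) x, Tendsto (fun n => avT T f n x) atTop (𝓝 (g f x)) :=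
    fun f x => (hg f).tendsto_at x
  have hl' : ∀ (f : C(X, ℝ)) x,
      Tendsto (fun n => ∫ y, f y ∂(empProb T x n : Measure X)) atTop (𝓝 (g f x)) := by
    intro f x
    simp only [integral_empProb]
    exact (tendsto_add_atTop_iff_nat 1).2 (hl f x)
  have hex : ∀ x, ∃ μ : ProbabilityMeasure X, ∀ f : C(X, ℝ), ∫ y, f y ∂(μ : Measure X) = g f x := by
    intro x
    obtain ⟨μ, -, hμ⟩ := isCompact_univ.ultrafilter_le_nhds
      ((hyperfilter ℕ).map (empProb T x)) (by simp)
    refine ⟨μ, fun f => ?_⟩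
    have h1 : Tendsto (empProb T x) (hyperfilter ℕ : Filter ℕ) (𝓝 μ) := hμ
    refine tendsto_nhds_unique ((tendsto_PM_iff _ _).1 h1 f) ((hl' f x).mono_left ?_)
    rw [← Nat.cofinite_eq_atTop]
    exact hyperfilter_le_cofinite
  choose m hm using hex
  refine ⟨m, ?_, ?_, ?_⟩
  · rw [ProbabilityMeasure.continuous_iff_forall_continuousMap_continuous_integral]
    intro f
    simp only [hm]
    exact (g f).continuous
  · intro x
    have : IsProbabilityMeasure (Measure.map T (m x).toMeasure) :=
      Measure.isProbabilityMeasure_map hT.aemeasurable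
    refine ext_of_forall_integral_eq_of_IsFiniteMeasure fun f => ?_
    rw [integral_map hT.aemeasurable f.continuous.aestronglyMeasurable]
    have e1 := hm x f.toContinuousMap
    have e2 := hm x (f.toContinuousMap.comp ⟨T, hT⟩)
    have e3 : g (f.toContinuousMap.comp ⟨T, hT⟩) x = g f.toContinuousMap x := by
      have h1 := (avT_shift T f f.continuous x).add (hl f.toContinuousMap x)
      refine tendsto_nhds_unique (hl _ x) ?_
      rw [zero_add] at h1
      refine h1.congr fun n => ?_
      have : ∀ k, T (T^[k] x) = T^[k] (T x) := fun k => by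
        rw [← Function.iterate_succ_apply, Function.iterate_succ_apply']
      simp [avT, this]
    exact e2.trans (e3.trans e1.symm)
  · intro x
    rw [tendsto_PM_iff]
    intro f
    rw [hm]
    exact hl' f x

lemma four_equi (T : X → X) (hT : Continuous T) (f g : C(X, ℝ))
    (h : TendstoUniformly (avT T f) g atTop) (ε : ℝ) (hε : 0 < ε) :
    ∃ δ > 0, ∀ x y : X, dist x y < δ → ∀ n, |avT T f n x - avT T f n y| < ε := by
  have hc : ∀ n, Continuous (avT T f n) := fun n => by
    unfold avT
    exact continuous_const.mul
      (continuous_finsetSum _ fun k _ => f.continuous.comp (hT.iterate k))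
  rw [Metric.tendstoUniformly_iff] at h
  obtain ⟨N, hN⟩ := eventually_atTop.1 (h (ε / 3) (by positivity))
  have e1 : ∀ n, ∀ᶠ p in uniformity X, dist (avT T f n p.1) (avT T f n p.2) < ε := fun n =>
    CompactSpace.uniformContinuous_of_continuous (hc n) (Metric.dist_mem_uniformity hε)
  have e2 : ∀ᶠ p in uniformity X, dist (g p.1) (g p.2) < ε / 3 :=
    CompactSpace.uniformContinuous_of_continuous g.continuous
      (Metric.dist_mem_uniformity (by positivity))
  have e3 := (Filter.eventually_all_finset (Finset.range N)).2 fun n _ => e1 n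
  obtain ⟨δ, hδ, hh⟩ := Metric.mem_uniformity_dist.1 (e2.and e3)
  refine ⟨δ, hδ, fun x y hxy n => ?_⟩
  obtain ⟨h1, h2⟩ := hh hxy
  rcases lt_or_ge n N with hn | hn
  · exact h2 n (by simpa using hn)
  · have a := hN n hn x
    have b := hN n hn y
    simp only [Real.dist_eq] at a b h1
    rw [abs_lt] at *
    constructor <;> linarith

lemma four_imp_two (T : X → X) (hT : Continuous T)
    (H : ∀ f : C(X, ℝ), ∃ g : C(X, ℝ), TendstoUniformly (avT T f) g atTop) :
    ∀ ε > (0 : ℝ), ∃ δ > (0 : ℝ), ∀ x y : X, ∀ n : ℕ, 0 < n → dist x y < δ →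
        levyProkhorovDist (empMeas T x n) (empMeas T y n) < ε := by
  intro ε hε
  by_contra hcon
  push Not at hcon
  have hpos : ∀ k : ℕ, (0 : ℝ) < 1 / ((k : ℝ) + 1) := fun k => by positivity
  choose x y n hn hd hLP using fun k : ℕ => hcon (1 / ((k : ℝ) + 1)) (hpos k)
  let μ : ℕ → ProbabilityMeasure X := fun k => empProb T (x k) (n k - 1)
  let ν : ℕ → ProbabilityMeasure X := fun k => empProb T (y k) (n k - 1)
  have hn1 : ∀ k, n k - 1 + 1 = n k := fun k => by have := hn k; omega
  have hLP' : ∀ k, ε ≤ levyProkhorovDist (μ k : Measure X) (ν k : Measure X) := by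
    intro k
    change ε ≤ levyProkhorovDist (empMeas T (x k) (n k - 1 + 1)) (empMeas T (y k) (n k - 1 + 1))
    rw [hn1]
    exact hLP k
  obtain ⟨μ', -, hμ⟩ := isCompact_univ.ultrafilter_le_nhds
      ((hyperfilter ℕ).map μ) (by simp)
  obtain ⟨ν', -, hν⟩ := isCompact_univ.ultrafilter_le_nhds
      ((hyperfilter ℕ).map ν) (by simp)
  have hμ : Tendsto μ (hyperfilter ℕ : Filter ℕ) (𝓝 μ') := hμ
  have hν : Tendsto ν (hyperfilter ℕ : Filter ℕ) (𝓝 ν') := hν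
  have hle : (hyperfilter ℕ : Filter ℕ) ≤ atTop := by
    rw [← Nat.cofinite_eq_atTop]
    exact hyperfilter_le_cofinite
  have heq : μ' = ν' := by
    refine PM_ext _ _ fun f => ?_
    have h1 := ((tendsto_PM_iff _ _).1 hμ f).sub ((tendsto_PM_iff _ _).1 hν f)
    have h2 : Tendsto (fun k => ∫ z, f z ∂(μ k : Measure X) - ∫ z, f z ∂(ν k : Measure X))
        (hyperfilter ℕ : Filter ℕ) (𝓝 0) := by
      refine Tendsto.mono_left ?_ hle
      rw [Metric.tendsto_nhds]
      intro r hr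
      obtain ⟨g, hg⟩ := H f
      obtain ⟨δ, hδ, hh⟩ := four_equi T hT f g hg r hr
      filter_upwards [(tendsto_one_div_add_atTop_nhds_zero_nat (𝕜 := ℝ)).eventually_lt_const hδ]
        with k hk
      rw [Real.dist_eq, sub_zero, integral_empProb, integral_empProb]
      exact hh _ _ ((hd k).trans hk) _
    exact sub_eq_zero.1 (tendsto_nhds_unique h1 h2)
  subst heq
  have c := LevyProkhorov.continuous_ofMeasure_probabilityMeasure (Ω := X)
  have t := ((c.tendsto μ').comp hμ).dist ((c.tendsto μ').comp hν)
  rw [dist_self] at t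
  obtain ⟨k, hk⟩ := (t.eventually_lt_const hε).exists
  exact absurd (hLP' k) (not_le.2 hk)

end EbarHelpers

/-- characterisation of `Ē`-continuity. The following are equivalent:
(1) `(X,T)` is `Ē`-continuous;
(2) the family of empirical measure maps `x ↦ m_T(x,n)`, `n ≥ 1`, is uniformly
equicontinuous from `(X,d)` to the probability measures with the Prokhorov metric;
(3) every `x ∈ X` is generic for some invariant measure `μ(x)` and `x ↦ μ(x)` is continuous;
(4) for every continuous `f : X → ℝ` the ergodic averages `(1/n) Σ_{k<n} f∘T^k` converge
uniformly on `X` to a continuous function. -/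
theorem EbarContinuous_characterisation {X : Type*} [MetricSpace X] [CompactSpace X]
    [MeasurableSpace X] [BorelSpace X] (T : X → X) (hT : Continuous T) :
    ((∀ ε > (0 : ℝ), ∃ δ > (0 : ℝ), ∀ x y : X, dist x y < δ → Ebar T x y < ε) ↔
      (∀ ε > (0 : ℝ), ∃ δ > (0 : ℝ), ∀ x y : X, ∀ n : ℕ, 0 < n → dist x y < δ →
        levyProkhorovDist (empMeas T x n) (empMeas T y n) < ε)) ∧
    ((∀ ε > (0 : ℝ), ∃ δ > (0 : ℝ), ∀ x y : X, dist x y < δ → Ebar T x y < ε) ↔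
      (∃ m : X → ProbabilityMeasure X, Continuous m ∧
        (∀ x : X, Measure.map T (m x).toMeasure = (m x).toMeasure) ∧
        (∀ x : X, Tendsto (empProb T x) atTop (𝓝 (m x))))) ∧
    ((∀ ε > (0 : ℝ), ∃ δ > (0 : ℝ), ∀ x y : X, dist x y < δ → Ebar T x y < ε) ↔
      (∀ f : C(X, ℝ), ∃ g : C(X, ℝ), TendstoUniformly
        (fun (n : ℕ) (x : X) => (1 / (n : ℝ)) * ∑ k ∈ Finset.range n, f (T^[k] x))
        g atTop)) := by
  have h14 : (∀ ε > (0 : ℝ), ∃ δ > (0 : ℝ), ∀ x y : X, dist x y < δ → Ebar T x y < ε) →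
      ∀ f : C(X, ℝ), ∃ g : C(X, ℝ), TendstoUniformly (avT T f) g atTop :=
    fun H f => five_imp_four T hT (one_imp_five T H) f f.continuous
  refine ⟨⟨fun H => four_imp_two T hT (h14 H), two_imp_one T⟩,
    ⟨fun H => four_imp_three T hT (h14 H),
      fun H => two_imp_one T (four_imp_two T hT (three_imp_four T hT H))⟩,
    ⟨h14, fun H => two_imp_one T (four_imp_two T hT H)⟩⟩
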